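/- arXiv:2006.06788 — 2 statements merged into one kernel-verified Lean document; each statement's English description precedes it below -/
import Mathlib

section
/- If λ, μ ∈ X are integral weights with λ ∼ μ, then the scalars in the linkage relation can be taken to be integers: there exist mutually B-orthogonal positive isotropic roots α₁,…,α_l, integers c₁,…,c_l ∈ ℤ, and w ∈ W with μ + ρ = w(λ + ρ − Σᵢ cᵢαᵢ) and B(λ + ρ, αᵢ) = 0 for all i. -/
noncomputable section

abbrev Vsp : Type := Fin 3 → ℂ

def BF (v w : Vsp) : ℂ := v 0 * w 0 + v 1 * w 1 - v 2 * w 2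

def d1 : Vsp := ![1, 0, 0]
def d2 : Vsp := ![0, 1, 0]
def ee : Vsp := ![0, 0, 1]

def oddPos : Set Vsp := {d1, d2, d1 - ee, d1 + ee, d2 - ee, d2 + ee}
def evenPos : Set Vsp := {(2 : ℂ) • d1, (2 : ℂ) • d2, d1 - d2, d1 + d2, ee}
def isotropicPos : Set Vsp := {α ∈ oddPos | BF α α = 0}

def rho : Vsp := ![1/2, -1/2, 1/2]

def reflFun (α : Vsp) (v : Vsp) : Vsp := v - (2 * BF v α / BF α α) • α

def W : Subgroup (Vsp ≃ₗ[ℂ] Vsp) :=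
  Subgroup.closure {e | ∃ α ∈ evenPos, ∀ v, e v = reflFun α v}

def atypDeg (l : Vsp) : ℕ :=
  sSup {n : ℕ | ∃ S : Finset Vsp, S.card = n ∧
    (∀ α ∈ S, α ∈ isotropicPos ∧ BF (l + rho) α = 0) ∧
    (∀ α ∈ S, ∀ β ∈ S, α ≠ β → BF α β = 0)}

def Linked (l m : Vsp) : Prop :=
  ∃ (k : ℕ) (α : Fin k → Vsp) (c : Fin k → ℂ) (w : Vsp ≃ₗ[ℂ] Vsp),
    w ∈ W ∧ (∀ i, α i ∈ isotropicPos) ∧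
    (∀ i j, i ≠ j → BF (α i) (α j) = 0) ∧
    (∀ i, BF (l + rho) (α i) = 0) ∧
    m + rho = w (l + rho - ∑ i, c i • α i)

lemma isotropicPos_third {α : Vsp} (h : α ∈ isotropicPos) : α 2 = 1 ∨ α 2 = -1 := by
  obtain ⟨h, h0⟩ := h
  rcases h with rfl | rfl | rfl | rfl | rfl | rfl <;>
    simp [BF, d1, d2, ee] at h0 ⊢

/-- The defect of `osp(3|4)` is one: orthogonal positive isotropic roots coincide. -/
lemma isotropicPos_eq_of_orthogonal {α β : Vsp} (hα : α ∈ isotropicPos)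
    (hβ : β ∈ isotropicPos) (h : BF α β = 0) : α = β := by
  obtain ⟨hα, hα0⟩ := hα
  obtain ⟨hβ, hβ0⟩ := hβ
  rcases hα with rfl | rfl | rfl | rfl | rfl | rfl <;>
    rcases hβ with rfl | rfl | rfl | rfl | rfl | rfl <;>
    first
    | rfl
    | simp [BF, d1, d2, ee] at h hα0 hβ0

lemma reflFun_third_sq {α : Vsp} (hα : α ∈ evenPos) (v : Vsp) :
    reflFun α v 2 ^ 2 = v 2 ^ 2 := by
  rcases hα with rfl | rfl | rfl | rfl | rfl <;>
    simp [reflFun, BF, d1, d2, ee]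
  ring

lemma W_third_sq {w : Vsp ≃ₗ[ℂ] Vsp} (hw : w ∈ W) (v : Vsp) : w v 2 ^ 2 = v 2 ^ 2 := by
  induction hw using Subgroup.closure_induction generalizing v with
  | mem e he =>
    obtain ⟨α, hα, he⟩ := he
    rw [he, reflFun_third_sq hα]
  | one => rfl
  | mul x y _ _ hx hy => rw [LinearEquiv.mul_apply, hx, hy]
  | inv x _ hx => rw [← hx, ← LinearEquiv.mul_apply, mul_inv_cancel, LinearEquiv.coe_one, id]

/-- The coefficient of an isotropic root relating two integral weights is an integer. -/
lemma exists_int_of_W_eq {l m α : Vsp} {C : ℂ} {w : Vsp ≃ₗ[ℂ] Vsp} (hw : w ∈ W)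
    (hα : α ∈ isotropicPos) (hl : ∃ n : ℤ, l 2 = n) (hm : ∃ n : ℤ, m 2 = n)
    (h : m + rho = w (l + rho - C • α)) : ∃ n : ℤ, C = n := by
  obtain ⟨a, ha⟩ := hl
  obtain ⟨b, hb⟩ := hm
  have key := W_third_sq hw (l + rho - C • α)
  rw [← h, sq_eq_sq_iff_eq_or_eq_neg] at key
  simp only [Pi.add_apply, Pi.sub_apply, Pi.smul_apply, smul_eq_mul, ha, hb,
    show rho 2 = 1 / 2 from rfl] at key
  rcases isotropicPos_third hα with h1 | h1 <;> rw [h1] at key <;> rcases key with h2 | h2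
  · exact ⟨a - b, by push_cast; linear_combination h2⟩
  · exact ⟨a + b + 1, by push_cast; linear_combination -h2⟩
  · exact ⟨b - a, by push_cast; linear_combination -h2⟩
  · exact ⟨-a - b - 1, by push_cast; linear_combination h2⟩

/-- For integral weights λ, μ ∈ X = ℤ³ that are linked, the scalars in the linkage
relation can be taken to be integers. -/
theorem stmt12 (l m : Vsp)
    (hl : ∀ i, ∃ n : ℤ, l i = n) (hm : ∀ i, ∃ n : ℤ, m i = n)
    (h : Linked l m) :
    ∃ (k : ℕ) (α : Fin k → Vsp) (c : Fin k → ℤ) (w : Vsp ≃ₗ[ℂ] Vsp),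
      w ∈ W ∧ (∀ i, α i ∈ isotropicPos) ∧
      (∀ i j, i ≠ j → BF (α i) (α j) = 0) ∧
      (∀ i, BF (l + rho) (α i) = 0) ∧
      m + rho = w (l + rho - ∑ i, (c i : ℂ) • α i) := by
  obtain ⟨k, α, c, w, hw, hα, horth, hat, heq⟩ := h
  rcases k with _ | k
  · exact ⟨0, α, 0, w, hw, hα, horth, hat, by simpa using heq⟩
  have hconst : ∀ i, α i = α 0 := fun i => by
    by_cases hi : i = 0
    · rw [hi]
    · exact isotropicPos_eq_of_orthogonal (hα i) (hα 0) (horth i 0 hi)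
  simp_rw [hconst, ← Finset.sum_smul] at heq
  obtain ⟨n, hn⟩ := exists_int_of_W_eq hw (hα 0) (hl 2) (hm 2) heq
  exact ⟨1, fun _ => α 0, fun _ => n, w, hw, fun _ => hα 0,
    fun i j hij => absurd (Subsingleton.elim i j) hij, fun _ => hat 0,
    by simpa [hn] using heq⟩
end
end

section
/- The weights (1/2, 1/2, 1/2) − ρ and (7/2, 7/2, 7/2) − ρ in h* are both atypical of degree 1, but they are not linked: it is not the case that (1/2, 1/2, 1/2) − ρ ∼ (7/2, 7/2, 7/2) − ρ. -/
noncomputable section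

/-- The isotropic positive roots orthogonal to a nonzero multiple of `(1, 1, 1)`. -/
lemma eq_of_mem_isotropicPos_of_BF_eq_zero {a : ℂ} (ha : a ≠ 0) {α : Vsp}
    (hα : α ∈ isotropicPos) (h : BF ![a, a, a] α = 0) : α = d1 + ee ∨ α = d2 + ee := by
  obtain ⟨h₁, h₂⟩ := hα
  rcases h₁ with rfl | rfl | rfl | rfl | rfl | rfl
  · simp [BF, d1] at h₂
  · simp [BF, d2] at h₂
  · simp [BF, d1, ee, ha] at h
  · exact Or.inl rfl
  · simp [BF, d2, ee, ha] at h
  · exact Or.inr rfl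

lemma BF_d1_add_ee_d2_add_ee : BF (d1 + ee) (d2 + ee) ≠ 0 := by
  simp [BF, d1, d2, ee]

lemma BF_d2_add_ee_d1_add_ee : BF (d2 + ee) (d1 + ee) ≠ 0 := by
  simp [BF, d1, d2, ee]

/-- Mutually orthogonal isotropic positive roots orthogonal to `(a, a, a)`, `a ≠ 0`, coincide. -/
lemma eq_of_orthogonal {a : ℂ} (ha : a ≠ 0) {α β : Vsp}
    (hα : α ∈ isotropicPos) (hα' : BF ![a, a, a] α = 0)
    (hβ : β ∈ isotropicPos) (hβ' : BF ![a, a, a] β = 0) (h : BF α β = 0) : α = β := by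
  rcases eq_of_mem_isotropicPos_of_BF_eq_zero ha hα hα' with rfl | rfl <;>
    rcases eq_of_mem_isotropicPos_of_BF_eq_zero ha hβ hβ' with rfl | rfl
  · rfl
  · exact absurd h BF_d1_add_ee_d2_add_ee
  · exact absurd h BF_d2_add_ee_d1_add_ee
  · rfl

lemma atypDeg_diagonal {a : ℂ} (ha : a ≠ 0) : atypDeg (![a, a, a] - rho) = 1 := by
  unfold atypDeg
  simp only [sub_add_cancel]
  refine IsGreatest.csSup_eq ⟨⟨{d1 + ee}, by simp, ?_, ?_⟩, ?_⟩
  · intro α hα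
    rw [Finset.mem_singleton.1 hα]
    refine ⟨⟨by simp [oddPos], ?_⟩, ?_⟩ <;> simp [BF, d1, ee]
  · intro α hα β hβ hne
    exact absurd ((Finset.mem_singleton.1 hα).trans (Finset.mem_singleton.1 hβ).symm) hne
  · rintro n ⟨S, rfl, hS, horth⟩
    refine Finset.card_le_one.2 fun α hα β hβ => ?_
    by_contra hne
    exact hne (eq_of_orthogonal ha (hS α hα).1 (hS α hα).2 (hS β hβ).1 (hS β hβ).2
      (horth α hα β hβ hne))

/-- Reflections in even roots preserve the set of squares of the `δ`-coordinates. -/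
lemma reflFun_sq_iff {α : Vsp} (hα : α ∈ evenPos) (v : Vsp) (t : ℂ) :
    (reflFun α v 0 ^ 2 = t ∨ reflFun α v 1 ^ 2 = t) ↔ (v 0 ^ 2 = t ∨ v 1 ^ 2 = t) := by
  rcases hα with rfl | rfl | rfl | rfl | rfl
  · have h₀ : reflFun ((2 : ℂ) • d1) v 0 = -v 0 := by simp [reflFun, BF, d1]; ring
    have h₁ : reflFun ((2 : ℂ) • d1) v 1 = v 1 := by simp [reflFun, BF, d1]
    rw [h₀, h₁, neg_sq]
  · have h₀ : reflFun ((2 : ℂ) • d2) v 0 = v 0 := by simp [reflFun, BF, d2]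
    have h₁ : reflFun ((2 : ℂ) • d2) v 1 = -v 1 := by simp [reflFun, BF, d2]; ring
    rw [h₀, h₁, neg_sq]
  · have h₀ : reflFun (d1 - d2) v 0 = v 1 := by simp [reflFun, BF, d1, d2]; ring
    have h₁ : reflFun (d1 - d2) v 1 = v 0 := by simp [reflFun, BF, d1, d2]; ring
    rw [h₀, h₁, or_comm]
  · have h₀ : reflFun (d1 + d2) v 0 = -v 1 := by simp [reflFun, BF, d1, d2]; ring
    have h₁ : reflFun (d1 + d2) v 1 = -v 0 := by simp [reflFun, BF, d1, d2]; ring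
    rw [h₀, h₁, neg_sq, neg_sq, or_comm]
  · have h₀ : reflFun ee v 0 = v 0 := by simp [reflFun, ee]
    have h₁ : reflFun ee v 1 = v 1 := by simp [reflFun, ee]
    rw [h₀, h₁]

lemma weyl_sq_iff {w : Vsp ≃ₗ[ℂ] Vsp} (hw : w ∈ W) (t : ℂ) :
    ∀ v : Vsp, (w v 0 ^ 2 = t ∨ w v 1 ^ 2 = t) ↔ (v 0 ^ 2 = t ∨ v 1 ^ 2 = t) := by
  induction hw using Subgroup.closure_induction with
  | mem e he =>
    obtain ⟨α, hα, h⟩ := he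
    intro v
    rw [h v]
    exact reflFun_sq_iff hα v t
  | one => exact fun v => Iff.rfl
  | mul x y _ _ hx hy => exact fun v => (hx (y v)).trans (hy v)
  | inv x _ hx =>
    intro v
    have h := hx (x⁻¹ v)
    rw [show x (x⁻¹ v) = v from x.apply_symm_apply v] at h
    exact h.symm

/-- Subtracting orthogonal isotropic roots from `(a, a, a)`, `a ≠ 0`, leaves one of the
`δ`-coordinates unchanged. -/
lemma sub_sum_apply_eq {a : ℂ} (ha : a ≠ 0) {k : ℕ} {α : Fin k → Vsp} (c : Fin k → ℂ)
    (hα : ∀ i, α i ∈ isotropicPos) (horth : ∀ i j, i ≠ j → BF (α i) (α j) = 0)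
    (h : ∀ i, BF ![a, a, a] (α i) = 0) :
    (![a, a, a] - ∑ i, c i • α i : Vsp) 0 = a ∨ (![a, a, a] - ∑ i, c i • α i : Vsp) 1 = a := by
  have hcases : (∀ i, α i = d2 + ee) ∨ ∀ i, α i = d1 + ee := by
    by_contra! hne
    obtain ⟨⟨i, hi⟩, j, hj⟩ := hne
    have hi' := (eq_of_mem_isotropicPos_of_BF_eq_zero ha (hα i) (h i)).resolve_right hi
    have hj' := (eq_of_mem_isotropicPos_of_BF_eq_zero ha (hα j) (h j)).resolve_left hj
    have hij : i ≠ j := by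
      rintro rfl
      exact hj hi'
    have hB := horth i j hij
    rw [hi', hj'] at hB
    exact BF_d1_add_ee_d2_add_ee hB
  rcases hcases with h' | h'
  · left
    simp [h', d2, ee]
  · right
    simp [h', d1, ee]

/-- The weights (1/2, 1/2, 1/2) - ρ and (7/2, 7/2, 7/2) - ρ are both atypical of
degree 1 but are not linked. -/
theorem stmt15 :
    atypDeg (![1/2, 1/2, 1/2] - rho) = 1 ∧
    atypDeg (![7/2, 7/2, 7/2] - rho) = 1 ∧
    ¬ Linked (![1/2, 1/2, 1/2] - rho) (![7/2, 7/2, 7/2] - rho) := by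
  refine ⟨atypDeg_diagonal (by norm_num), atypDeg_diagonal (by norm_num), ?_⟩
  rintro ⟨k, α, c, w, hw, hα, horth, h, heq⟩
  simp only [sub_add_cancel] at h heq
  have hsq := (weyl_sq_iff hw ((1 / 2 : ℂ) ^ 2) _).2
    ((sub_sum_apply_eq (by norm_num) c hα horth h).imp (congrArg (· ^ 2)) (congrArg (· ^ 2)))
  rw [← heq] at hsq
  norm_num at hsq
end
end
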